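/- arXiv:1410.5701 — 3 statements merged into one kernel-verified Lean document; each statement's English description precedes it below -/
import Mathlib

section
/- There is a universal constant C > 0 with the following property. Let K be a nonempty half-plane hull with hydrodynamic conformal map f : ℍ → ℍ \ K. If z ∈ ℍ satisfies Im(z) ≤ 10·diam(K), then Im(z) ≤ C·diam(K)·|f'(z)|, and consequently Im(z)² ≤ C·diam(K)·δ_{ℍ\K}(f(z)). -/
open Set Metric Filter Bornology Complex Function

noncomputable section

/-- The upper half-plane as a subset of `ℂ`. -/
def UHP : Set ℂ := {z : ℂ | 0 < z.im}

/-- `K` is a half-plane hull: a bounded subset of the upper half-plane whose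
complement in the upper half-plane is a simply connected domain. -/
def IsHull (K : Set ℂ) : Prop :=
  IsBounded K ∧ K ⊆ UHP ∧ IsOpen (UHP \ K) ∧ IsConnected (UHP \ K) ∧
    SimplyConnectedSpace ↥(UHP \ K)

/-- `f` is the hydrodynamic conformal map of the hull `K`: a conformal bijection
from the upper half-plane onto `UHP \ K` with `f z - z → 0` as `|z| → ∞` in `UHP`. -/
def IsHydroMap (K : Set ℂ) (f : ℂ → ℂ) : Prop :=
  DifferentiableOn ℂ f UHP ∧ InjOn f UHP ∧ f '' UHP = UHP \ K ∧
    Tendsto (fun z => f z - z) (cobounded ℂ ⊓ 𝓟 UHP) (nhds (0 : ℂ))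

/-- `f` is the hydrodynamic map of `K` and `g` is its inverse. -/
def IsHydroPair (K : Set ℂ) (f g : ℂ → ℂ) : Prop :=
  IsHydroMap K f ∧ InvOn g f UHP (UHP \ K)

/-- `K` has half-plane capacity `a`, computed via its hydrodynamic map `f`:
`z * (z - f z) → a` as `|z| → ∞` in `UHP`. -/
def HasHcap (K : Set ℂ) (f : ℂ → ℂ) (a : ℝ) : Prop :=
  Tendsto (fun z => z * (z - f z)) (cobounded ℂ ⊓ 𝓟 UHP) (nhds (a : ℂ))

/-- The `(β, C₀)`-Hölder condition for a map defined on the upper half-plane. -/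
def IsHolder (f : ℂ → ℂ) (β C₀ : ℝ) : Prop :=
  ∀ z ∈ UHP, ∀ z' ∈ UHP, dist (f z) (f z') ≤ C₀ * max (dist z z' ^ β) (dist z z')

/-- The Poincaré hyperbolic distance on the upper half-plane. -/
def rhoH (z w : ℂ) : ℝ :=
  2 * Real.arsinh (dist z w / (2 * Real.sqrt (z.im * w.im)))

/-- The hyperbolic distance on a simply connected domain `Ω`, transported through a
conformal bijection `φ : UHP → Ω` (independent of the choice of `φ`). -/
def rhoVia (φ : ℂ → ℂ) (z w : ℂ) : ℝ :=
  rhoH (invFunOn φ UHP z) (invFunOn φ UHP w)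

/-- `log⁺ x = max (log x) 0`. -/
def posLog (x : ℝ) : ℝ := max (Real.log x) 0

/-- Internal distance between `A` and `B` inside `Ω`: the infimum of diameters of
connected subsets of `Ω` meeting both `A` and `B`. -/
def distIn (Ω A B : Set ℂ) : ℝ :=
  sInf {d : ℝ | ∃ E : Set ℂ, E ⊆ Ω ∧ IsConnected E ∧ (E ∩ A).Nonempty ∧
    (E ∩ B).Nonempty ∧ d = Metric.diam E}

/-- Internal diameter of `A` inside `Ω`. -/
def diamIn (Ω A : Set ℂ) : ℝ :=
  sSup {d : ℝ | ∃ a ∈ A, ∃ b ∈ A, d = distIn Ω {a} {b}}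

/-- An `L`-John curve in `Ω` with tip `z`, parametrized on `[0,1)` (the base-point,
which is not required to lie in `Ω`, corresponds to the missing endpoint). -/
def IsJohnCurve (Ω : Set ℂ) (L : ℝ) (α : ℝ → ℂ) (z : ℂ) : Prop :=
  ContinuousOn α (Ico 0 1) ∧ InjOn α (Ico 0 1) ∧ α 0 = z ∧
    MapsTo α (Ico 0 1) Ω ∧
    ∀ t ∈ Ico (0:ℝ) 1, Metric.diam (α '' Icc 0 t) ≤ L * infDist (α t) (frontier Ω)

/-- An `L`-John curve in `Ω` with tip `z` and base-point `∞`, parametrized on `[0,∞)`. -/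
def IsJohnCurveInfty (Ω : Set ℂ) (L : ℝ) (α : ℝ → ℂ) (z : ℂ) : Prop :=
  ContinuousOn α (Ici 0) ∧ InjOn α (Ici 0) ∧ α 0 = z ∧
    MapsTo α (Ici 0) Ω ∧ Tendsto α atTop (cobounded ℂ) ∧
    ∀ t ∈ Ici (0:ℝ), Metric.diam (α '' Icc 0 t) ≤ L * infDist (α t) (frontier Ω)

/-- An injective holomorphic map sends neighbourhoods to neighbourhoods. -/
theorem inj_nhds_le {U : Set ℂ} (hU : IsOpen U) {f : ℂ → ℂ} (hf : DifferentiableOn ℂ f U)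
    (hi : InjOn f U) {z : ℂ} (hz : z ∈ U) : nhds (f z) ≤ map f (nhds z) := by
  have han : AnalyticAt ℂ f z := hf.analyticAt (hU.mem_nhds hz)
  rcases han.eventually_constant_or_nhds_le_map_nhds with h | h
  · exfalso
    have h1 : ∀ᶠ w in nhdsWithin z {z}ᶜ, f w = f z := h.filter_mono nhdsWithin_le_nhds
    have h2 : ∀ᶠ w in nhdsWithin z {z}ᶜ, w ∈ U :=
      hU.eventually_mem hz |>.filter_mono nhdsWithin_le_nhds
    have h3 : ∀ᶠ w in nhdsWithin z {z}ᶜ, w ≠ z := eventually_mem_nhdsWithin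
    obtain ⟨w, hw1, hw2, hw3⟩ := (h1.and (h2.and h3)).exists
    exact hw3 (hi hw2 hz hw1)
  · exact h

theorem inj_inv_continuousAt {U : Set ℂ} (hU : IsOpen U) {f g : ℂ → ℂ}
    (hf : DifferentiableOn ℂ f U) (hi : InjOn f U) (hg : ∀ z ∈ U, g (f z) = z)
    {z : ℂ} (hz : z ∈ U) : ContinuousAt g (f z) := by
  intro V hV
  rw [hg z hz] at hV
  rw [mem_map]
  have h1 : f '' (V ∩ U) ∈ nhds (f z) := by
    apply inj_nhds_le hU hf hi hz
    rw [mem_map]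
    exact mem_of_superset (inter_mem hV (hU.mem_nhds hz)) (subset_preimage_image f _)
  refine mem_of_superset h1 ?_
  rintro _ ⟨x, ⟨hxV, hxU⟩, rfl⟩
  simpa [hg x hxU] using hxV

theorem inj_isOpen_image {U : Set ℂ} (hU : IsOpen U) {f : ℂ → ℂ}
    (hf : DifferentiableOn ℂ f U) (hi : InjOn f U) : IsOpen (f '' U) := by
  rw [isOpen_iff_mem_nhds]
  rintro _ ⟨z, hz, rfl⟩
  apply inj_nhds_le hU hf hi hz
  rw [mem_map]
  exact mem_of_superset (hU.mem_nhds hz) (subset_preimage_image f _)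

theorem inj_inv_differentiableAt_aux {U : Set ℂ} (hU : IsOpen U) {f g : ℂ → ℂ}
    (hf : DifferentiableOn ℂ f U) (hi : InjOn f U) (hg : ∀ z ∈ U, g (f z) = z)
    {z : ℂ} (hz : z ∈ U) (h0 : deriv f z ≠ 0) : DifferentiableAt ℂ g (f z) := by
  have h1 : HasDerivAt f (deriv f z) (g (f z)) := by
    rw [hg z hz]
    exact (hf.differentiableAt (hU.mem_nhds hz)).hasDerivAt
  refine (h1.of_local_left_inverse (inj_inv_continuousAt hU hf hi hg hz) h0 ?_).differentiableAt
  filter_upwards [(inj_isOpen_image hU hf hi).mem_nhds (mem_image_of_mem f hz)]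
  rintro _ ⟨x, hx, rfl⟩
  rw [hg x hx]

theorem inj_inv_differentiableAt {U : Set ℂ} (hU : IsOpen U) {f g : ℂ → ℂ}
    (hf : DifferentiableOn ℂ f U) (hi : InjOn f U) (hg : ∀ z ∈ U, g (f z) = z)
    {z : ℂ} (hz : z ∈ U) : DifferentiableAt ℂ g (f z) := by
  have han : AnalyticAt ℂ (deriv f) z := (hf.analyticAt (hU.mem_nhds hz)).deriv
  rcases han.eventually_eq_zero_or_eventually_ne_zero with h | h
  · exfalso
    obtain ⟨r, hr, hrU⟩ := Metric.mem_nhds_iff.1 (inter_mem h (hU.mem_nhds hz))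
    have hc : ∀ x ∈ ball z r, f x = f z := by
      intro x hx
      refine (convex_ball z r).is_const_of_fderivWithin_eq_zero (𝕜 := ℂ)
        (hf.mono fun y hy => (hrU hy).2) ?_ hx (mem_ball_self hr)
      intro y hy
      rw [fderivWithin_of_isOpen isOpen_ball hy]
      ext
      have : deriv f y = 0 := (hrU hy).1
      simpa using this
    have hx : z + (r / 2 : ℝ) ∈ ball z r := by
      rw [mem_ball, dist_eq_norm, add_sub_cancel_left, Complex.norm_real, Real.norm_eq_abs,
        abs_of_pos (by positivity)]
      linarith
    have := hi (hrU hx).2 hz (hc _ hx)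
    rw [add_eq_left] at this
    have h4 : r / 2 = 0 := by exact_mod_cast this
    linarith
  · have hca := inj_inv_continuousAt hU hf hi hg hz
    refine (Complex.analyticAt_of_differentiable_on_punctured_nhds_of_continuousAt ?_
      hca).differentiableAt
    have hset : f '' ({x | x ≠ z → deriv f x ≠ 0} ∩ U) ∈ nhds (f z) := by
      apply inj_nhds_le hU hf hi hz
      rw [mem_map]
      refine mem_of_superset (inter_mem ?_ (hU.mem_nhds hz)) (subset_preimage_image f _)
      exact eventually_nhdsWithin_iff.1 h
    rw [eventually_nhdsWithin_iff]
    filter_upwards [hset]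
    rintro _ ⟨x, ⟨hx1, hx2⟩, rfl⟩ hne
    refine inj_inv_differentiableAt_aux hU hf hi hg hx2 (hx1 ?_)
    rintro rfl
    exact hne rfl

theorem inj_deriv_mul {U : Set ℂ} (hU : IsOpen U) {f g : ℂ → ℂ}
    (hf : DifferentiableOn ℂ f U) (hi : InjOn f U) (hg : ∀ z ∈ U, g (f z) = z)
    {z : ℂ} (hz : z ∈ U) : deriv g (f z) * deriv f z = 1 := by
  have h1 := (inj_inv_differentiableAt hU hf hi hg hz).hasDerivAt.comp z
    (hf.differentiableAt (hU.mem_nhds hz)).hasDerivAt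
  have h2 : HasDerivAt (g ∘ f) 1 z := by
    refine (hasDerivAt_id z).congr_of_eventuallyEq ?_
    filter_upwards [hU.mem_nhds hz] with x hx using hg x hx
  exact h1.unique h2

theorem inj_deriv_ne_zero {U : Set ℂ} (hU : IsOpen U) {f : ℂ → ℂ}
    (hf : DifferentiableOn ℂ f U) (hi : InjOn f U)
    {z : ℂ} (hz : z ∈ U) : deriv f z ≠ 0 := by
  have := inj_deriv_mul hU hf hi (g := invFunOn f U) (fun x hx => hi.leftInvOn_invFunOn hx) hz
  exact right_ne_zero_of_mul_eq_one this

theorem sq_lower (z k b : ℂ) (t : ℝ) (ht : 0 < t) (hz : ‖z‖ = t) :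
    (t ^ 4)⁻¹ + ‖b‖ ^ 2 +
      2 * (-(((t ^ 4)⁻¹ : ℝ) : ℂ) * (z ^ 2 * k) + (starRingEnd ℂ) b * (k - b)).re
      ≤ ‖-(z ^ 2)⁻¹ + k‖ ^ 2 := by
  have hz0 : z ≠ 0 := by
    rintro rfl
    simp at hz
    linarith
  have hns : ∀ w : ℂ, ‖w‖ ^ 2 = normSq w := fun w => (normSq_eq_norm_sq w).symm
  have e1 : ‖-(z ^ 2)⁻¹ + k‖ ^ 2 =
      (t ^ 4)⁻¹ + ‖k‖ ^ 2 + 2 * (-(((t ^ 4)⁻¹ : ℝ) : ℂ) * (z ^ 2 * k)).re := by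
    rw [hns, normSq_add, ← hns, ← hns]
    have h1 : ‖-(z ^ 2)⁻¹‖ ^ 2 = (t ^ 4)⁻¹ := by
      rw [norm_neg, norm_inv, norm_pow, hz]
      ring
    have h2 : (starRingEnd ℂ) k * (-(z ^ 2)⁻¹) = (starRingEnd ℂ)
        (-(((t ^ 4)⁻¹ : ℝ) : ℂ) * (z ^ 2 * k)) := by
      have h3 : ((t ^ 4 : ℝ) : ℂ) = (z * (starRingEnd ℂ) z) ^ 2 := by
        rw [mul_conj, ← hns, hz]
        push_cast
        ring
      have h4 : (starRingEnd ℂ) z ≠ 0 := by simpa using hz0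
      rw [map_mul, map_neg, conj_ofReal, ofReal_inv, h3, map_mul, map_pow]
      field_simp
    have h5 : (-(z ^ 2)⁻¹ * (starRingEnd ℂ) k).re = (-(((t ^ 4)⁻¹ : ℝ) : ℂ) * (z ^ 2 * k)).re := by
      rw [mul_comm, h2, conj_re]
    rw [h1, h5]
  have e2 : ‖k‖ ^ 2 = ‖b‖ ^ 2 + 2 * ((starRingEnd ℂ) b * (k - b)).re + ‖k - b‖ ^ 2 := by
    simp only [hns, normSq_apply, mul_re, sub_re, sub_im, conj_re, conj_im]
    ring
  rw [e1, e2, add_re]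
  nlinarith [sq_nonneg ‖k - b‖]

theorem circle_lower {κ : ℂ → ℂ} (hκ : DifferentiableOn ℂ κ (ball 0 1)) {t : ℝ} (ht : 0 < t)
    (ht1 : t < 1) :
    2 * Real.pi * ((t ^ 4)⁻¹ + ‖κ 0‖ ^ 2) ≤
      ∫ θ in (-Real.pi)..Real.pi, ‖-((circleMap 0 t θ) ^ 2)⁻¹ + κ (circleMap 0 t θ)‖ ^ 2 := by
  set b := κ 0 with hb
  set Φ : ℂ → ℂ := fun z => -(((t ^ 4)⁻¹ : ℝ) : ℂ) * (z ^ 2 * κ z) +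
    (starRingEnd ℂ) b * (κ z - b) with hΦ
  have hΦd : DifferentiableOn ℂ Φ (ball 0 1) := by
    intro z hz
    have := hκ z hz
    fun_prop
  have hnorm : ∀ θ, ‖circleMap 0 t θ‖ = t := by
    intro θ
    simp [abs_of_pos ht]
  have hmem : ∀ θ, circleMap 0 t θ ∈ ball (0:ℂ) 1 := by
    intro θ
    rw [mem_ball_zero_iff, hnorm]
    exact ht1
  have hne : ∀ θ, circleMap 0 t θ ≠ 0 := by
    intro θ h
    have := hnorm θ
    rw [h, norm_zero] at this
    linarith
  have hcc : Continuous fun θ => κ (circleMap 0 t θ) :=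
    hκ.continuousOn.comp_continuous (continuous_circleMap 0 t) hmem
  have hcΦ : Continuous fun θ => Φ (circleMap 0 t θ) :=
    hΦd.continuousOn.comp_continuous (continuous_circleMap 0 t) hmem
  have havg : Real.circleAverage Φ 0 t = Φ 0 := by
    apply DiffContOnCl.circleAverage
    rw [abs_of_pos ht]
    apply DifferentiableOn.diffContOnCl
    rw [closure_ball _ ht.ne']
    exact hΦd.mono (closedBall_subset_ball ht1)
  have hΦ0 : Φ 0 = 0 := by simp [hΦ, hb]
  have hInt0 : ∫ θ in (-Real.pi)..Real.pi, Φ (circleMap 0 t θ) = 0 := by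
    rw [hΦ0, Real.circleAverage] at havg
    have h1 : ∫ θ in (0:ℝ)..(2 * Real.pi), Φ (circleMap 0 t θ) = 0 := by
      rcases smul_eq_zero.1 havg with h | h
      · exfalso
        have := Real.pi_pos
        have h3 : (2 * Real.pi)⁻¹ > 0 := by positivity
        linarith
      · exact h
    have hper : Function.Periodic (fun θ => Φ (circleMap 0 t θ)) (2 * Real.pi) := by
      intro θ
      simp only [periodic_circleMap 0 t θ]
    have := hper.intervalIntegral_add_eq (-Real.pi) 0
    rw [zero_add, h1] at this
    rw [show -Real.pi + 2 * Real.pi = Real.pi by ring] at this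
    exact this
  have hre : ∫ θ in (-Real.pi)..Real.pi, (Φ (circleMap 0 t θ)).re = 0 := by
    have := reCLM.intervalIntegral_comp_comm (hcΦ.intervalIntegrable (μ := MeasureTheory.volume) (-Real.pi) Real.pi)
    rw [hInt0] at this
    simpa using this
  have hlow : ∫ θ in (-Real.pi)..Real.pi,
      ((t ^ 4)⁻¹ + ‖b‖ ^ 2 + 2 * (Φ (circleMap 0 t θ)).re) =
      2 * Real.pi * ((t ^ 4)⁻¹ + ‖b‖ ^ 2) := by
    have hc2 : Continuous fun θ => 2 * (Φ (circleMap 0 t θ)).re :=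
      continuous_const.mul (continuous_re.comp hcΦ)
    rw [intervalIntegral.integral_add (by simp) (hc2.intervalIntegrable _ _),
      intervalIntegral.integral_const_mul, hre, intervalIntegral.integral_const, smul_eq_mul]
    ring
  rw [← hlow]
  apply intervalIntegral.integral_mono_on (by linarith [Real.pi_pos])
  · apply Continuous.intervalIntegrable
    exact continuous_const.add (continuous_const.mul (continuous_re.comp hcΦ))
  · apply Continuous.intervalIntegrable
    have : Continuous fun θ => (circleMap 0 t θ ^ 2)⁻¹ :=
      ((continuous_circleMap 0 t).pow 2).inv₀ fun θ => pow_ne_zero 2 (hne θ)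
    exact (this.neg.add hcc).norm.pow 2
  · intro θ _
    exact sq_lower _ _ _ t ht (hnorm θ)

theorem annulus_lower {κ : ℂ → ℂ} (hκ : DifferentiableOn ℂ κ (ball 0 1)) {s r : ℝ} (hs : 0 < s)
    (hsr : s ≤ r) (hr1 : r < 1) :
    Real.pi * ((s ^ 2)⁻¹ - (r ^ 2)⁻¹) + Real.pi * ‖κ 0‖ ^ 2 * (r ^ 2 - s ^ 2) ≤
      ∫ z in {z : ℂ | ‖z‖ ∈ Icc s r}, ‖-(z ^ 2)⁻¹ + κ z‖ ^ 2 := by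
  have hA : MeasurableSet {z : ℂ | ‖z‖ ∈ Icc s r} := measurable_norm measurableSet_Icc
  set q : ℂ → ℝ := fun z => ‖-(z ^ 2)⁻¹ + κ z‖ ^ 2 with hq
  rw [← MeasureTheory.integral_indicator hA, ← Complex.integral_comp_polarCoord_symm]
  set Q : ℝ × ℝ → ℝ := fun p => p.1 * q (circleMap 0 p.1 p.2) with hQ
  have hcm : Continuous fun p : ℝ × ℝ => circleMap 0 p.1 p.2 := by
    unfold circleMap
    fun_prop
  have hQc : ContinuousOn Q (Icc s r ×ˢ Icc (-Real.pi) Real.pi) := by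
    have hmaps : MapsTo (fun p : ℝ × ℝ => circleMap 0 p.1 p.2)
        (Icc s r ×ˢ Icc (-Real.pi) Real.pi) (ball 0 1) := by
      rintro ⟨t, θ⟩ ⟨ht, -⟩
      have ht' : s ≤ t ∧ t ≤ r := ht
      rw [mem_ball_zero_iff]
      simp only [norm_circleMap_zero]
      rw [abs_of_pos (by linarith)]
      linarith
    have h1 : ContinuousOn (fun p : ℝ × ℝ => κ (circleMap 0 p.1 p.2))
        (Icc s r ×ˢ Icc (-Real.pi) Real.pi) := hκ.continuousOn.comp hcm.continuousOn hmaps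
    have h2 : ContinuousOn (fun p : ℝ × ℝ => ((circleMap 0 p.1 p.2) ^ 2)⁻¹)
        (Icc s r ×ˢ Icc (-Real.pi) Real.pi) := by
      refine (hcm.pow 2).continuousOn.inv₀ ?_
      rintro ⟨t, θ⟩ ⟨ht, -⟩
      have ht' : s ≤ t ∧ t ≤ r := ht
      apply pow_ne_zero
      simp only [ne_eq, circleMap_eq_center_iff]
      linarith
    exact continuous_fst.continuousOn.mul ((h2.neg.add h1).norm.pow 2)
  have hQi : MeasureTheory.IntegrableOn Q (Icc s r ×ˢ Ioo (-Real.pi) Real.pi)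
      MeasureTheory.volume :=
    (hQc.integrableOn_compact (isCompact_Icc.prod isCompact_Icc)).mono_set
      (prod_mono le_rfl Ioo_subset_Icc_self)
  have e1 : ∫ p in polarCoord.target, p.1 • ({z : ℂ | ‖z‖ ∈ Icc s r}.indicator q)
      (Complex.polarCoord.symm p) = ∫ p in Icc s r ×ˢ Ioo (-Real.pi) Real.pi, Q p := by
    have hmI : MeasurableSet (Icc s r ×ˢ Ioo (-Real.pi) Real.pi) :=
      measurableSet_Icc.prod measurableSet_Ioo
    have hmT : MeasurableSet polarCoord.target := polarCoord.open_target.measurableSet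
    rw [← MeasureTheory.integral_indicator hmT, ← MeasureTheory.integral_indicator hmI]
    congr 1
    ext ⟨t, θ⟩
    have hcp : Complex.polarCoord.symm (t, θ) = circleMap 0 t θ := by
      rw [Complex.polarCoord_symm_apply, circleMap, exp_mul_I]
      simp
    by_cases ht : (t, θ) ∈ Icc s r ×ˢ Ioo (-Real.pi) Real.pi
    · have ht2 : s ≤ t ∧ t ≤ r := ht.1
      have ht' : (t, θ) ∈ polarCoord.target := ⟨by simp; linarith, ht.2⟩
      rw [indicator_of_mem ht, indicator_of_mem ht', hcp, indicator_of_mem]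
      · rfl
      · simp only [mem_ofPred_eq, norm_circleMap_zero]
        rw [abs_of_pos (by linarith)]
        exact ht2
    · rw [indicator_of_notMem ht]
      by_cases ht' : (t, θ) ∈ polarCoord.target
      · rw [indicator_of_mem ht', hcp, indicator_of_notMem, smul_zero]
        simp only [mem_ofPred_eq, norm_circleMap_zero]
        have h0 : 0 < t := ht'.1
        rw [abs_of_pos h0]
        exact fun h => ht ⟨h, ht'.2⟩
      · rw [indicator_of_notMem ht']
  rw [e1, MeasureTheory.Measure.volume_eq_prod, MeasureTheory.setIntegral_prod _ hQi]
  have e2 : Real.pi * ((s ^ 2)⁻¹ - (r ^ 2)⁻¹) + Real.pi * ‖κ 0‖ ^ 2 * (r ^ 2 - s ^ 2) =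
      ∫ t in Icc s r, t * (2 * Real.pi * ((t ^ 4)⁻¹ + ‖κ 0‖ ^ 2)) := by
    rw [MeasureTheory.integral_Icc_eq_integral_Ioc, ← intervalIntegral.integral_of_le hsr]
    symm
    have := intervalIntegral.integral_eq_sub_of_hasDerivAt (a := s) (b := r)
      (f := fun t : ℝ => -Real.pi * (t ^ 2)⁻¹ + Real.pi * ‖κ 0‖ ^ 2 * t ^ 2)
      (f' := fun t => t * (2 * Real.pi * ((t ^ 4)⁻¹ + ‖κ 0‖ ^ 2))) ?_ ?_
    · rw [this]
      ring
    · intro t ht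
      rw [uIcc_of_le hsr] at ht
      have ht0 : t ≠ 0 := by linarith [ht.1]
      have h1 : HasDerivAt (fun t : ℝ => t ^ 2) (2 * t) t := by
        simpa using hasDerivAt_pow 2 t
      have h2 := ((h1.inv (pow_ne_zero 2 ht0)).const_mul (-Real.pi)).add
        (h1.const_mul (Real.pi * ‖κ 0‖ ^ 2))
      refine h2.congr_deriv ?_
      field_simp
    · apply ContinuousOn.intervalIntegrable
      rw [uIcc_of_le hsr]
      intro t ht
      have ht0 : t ^ 4 ≠ 0 := pow_ne_zero 4 (by linarith [ht.1])
      apply ContinuousAt.continuousWithinAt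
      fun_prop (disch := assumption)
  rw [e2]
  apply MeasureTheory.setIntegral_mono_on
  · apply ContinuousOn.integrableOn_compact isCompact_Icc
    intro t ht
    have ht0 : t ^ 4 ≠ 0 := pow_ne_zero 4 (by linarith [ht.1])
    apply ContinuousAt.continuousWithinAt
    fun_prop (disch := assumption)
  · have := hQi
    rw [MeasureTheory.IntegrableOn, MeasureTheory.Measure.volume_eq_prod,
      ← MeasureTheory.Measure.prod_restrict] at this
    exact this.integral_prod_left
  · exact measurableSet_Icc
  · intro t ht
    have ht' : s ≤ t ∧ t ≤ r := ht
    have := circle_lower hκ (t := t) (by linarith) (by linarith)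
    rw [MeasureTheory.integral_const_mul]
    apply mul_le_mul_of_nonneg_left _ (by linarith)
    rw [← MeasureTheory.integral_Ioc_eq_integral_Ioo,
      ← intervalIntegral.integral_of_le (by linarith [Real.pi_pos])]
    exact this

theorem det_conj_lin (β : ℂ) :
    LinearMap.det ((LinearMap.id : ℂ →ₗ[ℝ] ℂ) -
      (LinearMap.mulLeft ℝ β).comp (conjAe.toLinearMap)) = 1 - ‖β‖ ^ 2 := by
  rw [← LinearMap.det_toMatrix basisOneI, Matrix.det_fin_two, ← normSq_eq_norm_sq, normSq_apply]
  simp [LinearMap.toMatrix_apply, basisOneI]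
  ring

theorem det_mul_lin (c : ℂ) :
    ((ContinuousLinearMap.toSpanSingleton ℂ c).restrictScalars ℝ : ℂ →L[ℝ] ℂ).det = ‖c‖ ^ 2 := by
  rw [ContinuousLinearMap.det, ← LinearMap.det_toMatrix basisOneI, Matrix.det_fin_two,
    ← normSq_eq_norm_sq, normSq_apply]
  simp [LinearMap.toMatrix_apply, basisOneI]

theorem ellipse_bound {z k b : ℂ} {s t M N : ℝ} (hs : 0 < s) (hst : s ≤ t) (ht1 : t ≤ 1)
    (hz : ‖z‖ = t) (hM : 0 ≤ M) (hk : ‖k - b * z‖ ≤ M * t ^ 2)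
    (hN : N = M + ‖b‖ ^ 2 + ‖b‖ * M + 1) (hs1 : 4 * ‖b‖ * s ≤ 1) (hs2 : 4 * N * s ≤ 1) :
    ‖(z⁻¹ + k) - b * (s : ℂ) ^ 2 * (starRingEnd ℂ) (z⁻¹ + k)‖ ≤ s⁻¹ + 4 * N * s ^ 2 := by
  have ht : 0 < t := by linarith
  have hz0 : z ≠ 0 := by
    rintro rfl
    simp at hz
    linarith
  set D := ‖b‖ with hD
  have hD0 : 0 ≤ D := norm_nonneg b
  have hcz : (starRingEnd ℂ) z⁻¹ = z / (t : ℂ) ^ 2 := by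
    have h3 : (t : ℂ) ^ 2 = z * (starRingEnd ℂ) z := by
      rw [mul_conj, normSq_eq_norm_sq, hz]
      push_cast
      ring
    have h4 : (starRingEnd ℂ) z ≠ 0 := by simpa using hz0
    rw [h3, map_inv₀]
    field_simp
  have htC : (t : ℂ) ≠ 0 := by exact_mod_cast ht.ne'
  have e : (z⁻¹ + k) - b * (s : ℂ) ^ 2 * (starRingEnd ℂ) (z⁻¹ + k) =
      z⁻¹ + b * z * ((1 - s ^ 2 / t ^ 2 : ℝ) : ℂ) + (k - b * z) +
        -(b * (s : ℂ) ^ 2 * (starRingEnd ℂ) k) := by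
    rw [map_add, hcz]
    push_cast
    ring
  have hkn : ‖k‖ ≤ D * t + M * t ^ 2 := by
    calc ‖k‖ = ‖b * z + (k - b * z)‖ := by congr 1; ring
      _ ≤ ‖b * z‖ + ‖k - b * z‖ := norm_add_le _ _
      _ ≤ D * t + M * t ^ 2 := by rw [norm_mul, hz]; linarith
  have h0 : 0 ≤ 1 - s ^ 2 / t ^ 2 := by
    have : s ^ 2 / t ^ 2 ≤ 1 := by
      rw [div_le_one (by positivity)]
      gcongr
    linarith
  have hb1 : ‖b * z * ((1 - s ^ 2 / t ^ 2 : ℝ) : ℂ)‖ = D * t * (1 - s ^ 2 / t ^ 2) := by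
    rw [norm_mul, norm_mul, hz, norm_real, Real.norm_of_nonneg h0]
  have hb2 : ‖-(b * (s : ℂ) ^ 2 * (starRingEnd ℂ) k)‖ ≤ D * s ^ 2 * (D * t + M * t ^ 2) := by
    rw [norm_neg, norm_mul, norm_mul, norm_pow, norm_real, Real.norm_of_nonneg hs.le,
      RCLike.norm_conj]
    gcongr
  have hb0 : ‖z⁻¹‖ = t⁻¹ := by rw [norm_inv, hz]
  have htot : ‖(z⁻¹ + k) - b * (s : ℂ) ^ 2 * (starRingEnd ℂ) (z⁻¹ + k)‖ ≤
      t⁻¹ + D * t * (1 - s ^ 2 / t ^ 2) + M * t ^ 2 + D * s ^ 2 * (D * t + M * t ^ 2) := by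
    rw [e]
    refine (norm_add_le _ _).trans (add_le_add ((norm_add_le _ _).trans (add_le_add
      ((norm_add_le _ _).trans (add_le_add hb0.le hb1.le)) hk)) hb2)
  refine htot.trans ?_
  have hst2 : s ^ 2 ≤ t ^ 2 := by gcongr
  have hs_le : s ^ 2 ≤ t := by nlinarith
  have r1 : M * t ^ 2 + D * s ^ 2 * (D * t + M * t ^ 2) ≤ N * t ^ 2 := by
    have a1 : s ^ 2 * t ≤ t ^ 2 := by
      rw [pow_two t]
      gcongr
    have a2 : s ^ 2 * t ^ 2 ≤ t ^ 2 := mul_le_of_le_one_left (sq_nonneg t) (by linarith)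
    have a3 : D ^ 2 * (s ^ 2 * t) ≤ D ^ 2 * t ^ 2 := by gcongr
    have a4 : D * M * (s ^ 2 * t ^ 2) ≤ D * M * t ^ 2 := by gcongr
    have a5 : D * s ^ 2 * (D * t + M * t ^ 2) = D ^ 2 * (s ^ 2 * t) + D * M * (s ^ 2 * t ^ 2) := by
      ring
    have a6 : N * t ^ 2 = M * t ^ 2 + D ^ 2 * t ^ 2 + D * M * t ^ 2 + t ^ 2 := by
      rw [hN]
      ring
    rw [a5, a6]
    linarith [sq_nonneg t]
  have r2 : D * t * (1 - s ^ 2 / t ^ 2) ≤ (s⁻¹ - t⁻¹) / 2 := by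
    have e1 : D * t * (1 - s ^ 2 / t ^ 2) = D * (t - s) * (t + s) / t := by
      field_simp
      ring
    have e2 : (s⁻¹ - t⁻¹) / 2 = (t - s) * (1 / (2 * s)) / t := by
      field_simp
    rw [e1, e2]
    gcongr ?_ / t
    have : D * (t + s) ≤ 1 / (2 * s) := by
      rw [le_div_iff₀ (by positivity)]
      have : D * s * (t + s) ≤ D * s * 2 := by
        gcongr
        linarith
      have e3 : D * (t + s) * (2 * s) = 2 * (D * s * (t + s)) := by ring
      rw [e3]
      linarith
    have e4 : D * (t - s) * (t + s) = (t - s) * (D * (t + s)) := by ring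
    rw [e4]
    exact mul_le_mul_of_nonneg_left this (by linarith)
  have hN0 : 0 < N := by
    rw [hN]
    positivity
  have r3 : N * t ^ 2 ≤ (s⁻¹ - t⁻¹) / 2 + 4 * N * s ^ 2 := by
    rcases le_total t (2 * s) with h | h
    · have : t⁻¹ ≤ s⁻¹ := by gcongr
      have h2 : N * t ^ 2 ≤ N * (2 * s) ^ 2 := by gcongr
      have h3 : N * (2 * s) ^ 2 = 4 * N * s ^ 2 := by ring
      linarith
    · have h1 : t⁻¹ ≤ (2 * s)⁻¹ := by gcongr
      have h2 : (2 * s)⁻¹ = s⁻¹ / 2 := by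
        rw [mul_inv]
        ring
      have h3 : 4 * N ≤ s⁻¹ := by
        rw [← one_div, le_div_iff₀ hs]
        exact hs2
      have h4 : N * t ^ 2 ≤ N := mul_le_of_le_one_right hN0.le (pow_le_one₀ ht.le ht1)
      have h5 : 0 ≤ N * s ^ 2 := by positivity
      linarith
  linarith

theorem area_ineq {κ : ℂ → ℂ} (hκ : DifferentiableOn ℂ κ (ball 0 1)) (h0 : κ 0 = 0)
    (hinj : InjOn (fun z => z⁻¹ + κ z) (ball 0 1 \ {0})) {r : ℝ} (hr0 : 0 < r) (hr1 : r < 1) :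
    ∃ N > 0, ∀ s > 0, s ≤ r → 4 * ‖deriv κ 0‖ * s ≤ 1 → 4 * N * s ≤ 1 →
      (1 - (‖deriv κ 0‖ * s ^ 2) ^ 2) *
      (((s ^ 2)⁻¹ - (r ^ 2)⁻¹) + ‖deriv κ 0‖ ^ 2 * (r ^ 2 - s ^ 2)) ≤
        (s⁻¹ + 4 * N * s ^ 2) ^ 2 := by
  set b := deriv κ 0 with hb
  have hnh : ball (0:ℂ) 1 ∈ nhds (0:ℂ) := ball_mem_nhds 0 one_pos
  set κ1 := dslope κ 0 with hκ1
  have hκ1d : DifferentiableOn ℂ κ1 (ball 0 1) := (Complex.differentiableOn_dslope hnh).2 hκ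
  set κ2 := dslope κ1 0 with hκ2
  have hκ2d : DifferentiableOn ℂ κ2 (ball 0 1) := (Complex.differentiableOn_dslope hnh).2 hκ1d
  have hcs : closedBall (0:ℂ) r ⊆ ball 0 1 := closedBall_subset_ball hr1
  obtain ⟨M, hM⟩ := (isCompact_closedBall (0:ℂ) r).exists_bound_of_continuousOn
    (hκ2d.continuousOn.mono hcs)
  have hM0 : 0 ≤ M := (norm_nonneg _).trans (hM 0 (by simp [hr0.le]))
  have hrem : ∀ z ∈ closedBall (0:ℂ) r, ‖κ z - b * z‖ ≤ M * ‖z‖ ^ 2 := by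
    intro z hz
    have e1 : κ z = z * κ1 z := by
      have := sub_smul_dslope κ 0 z
      simpa [h0] using this.symm
    have e2 : κ1 z = b + z * κ2 z := by
      have := sub_smul_dslope κ1 0 z
      simp only [sub_zero, smul_eq_mul] at this
      rw [hκ2, this, hκ1, dslope_same]
      ring
    have e3 : κ z - b * z = κ2 z * z ^ 2 := by
      rw [e1, e2]
      ring
    rw [e3, norm_mul, norm_pow]
    gcongr
    exact hM z hz
  refine ⟨M + ‖b‖ ^ 2 + ‖b‖ * M + 1, by positivity, ?_⟩
  intro s hs hsr hs1 hs2
  set N := M + ‖b‖ ^ 2 + ‖b‖ * M + 1 with hN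
  set A : Set ℂ := {z : ℂ | ‖z‖ ∈ Icc s r} with hA
  have hAm : MeasurableSet A := measurable_norm measurableSet_Icc
  have hAsub : A ⊆ ball 0 1 \ {0} := by
    intro z hz
    have hz' : s ≤ ‖z‖ ∧ ‖z‖ ≤ r := hz
    refine ⟨by rw [mem_ball_zero_iff]; linarith, ?_⟩
    rintro rfl
    simp at hz'
    linarith
  set h : ℂ → ℂ := fun z => z⁻¹ + κ z with hh
  have hderiv : ∀ z ∈ A, HasDerivAt h (-(z ^ 2)⁻¹ + deriv κ z) z := by
    intro z hz
    have hz' := hAsub hz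
    exact (hasDerivAt_inv hz'.2).add
      (hκ.differentiableAt (isOpen_ball.mem_nhds hz'.1)).hasDerivAt
  have hκ'd : DifferentiableOn ℂ (deriv κ) (ball 0 1) := hκ.deriv isOpen_ball
  have hvol : ∫ z in A, ‖-(z ^ 2)⁻¹ + deriv κ z‖ ^ 2 = MeasureTheory.volume.real (h '' A) := by
    have := MeasureTheory.integral_image_eq_integral_abs_det_fderiv_smul
      (MeasureTheory.volume : MeasureTheory.Measure ℂ) hAm (f := h)
      (f' := fun z => (ContinuousLinearMap.toSpanSingleton ℂ
        (-(z ^ 2)⁻¹ + deriv κ z)).restrictScalars ℝ)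
      (fun z hz => ((hderiv z hz).hasFDerivAt.restrictScalars ℝ).hasFDerivWithinAt)
      (hinj.mono hAsub) (fun _ => (1:ℝ))
    simp only [det_mul_lin, smul_eq_mul, mul_one, abs_pow, abs_norm] at this
    rw [← this]
    simp
  have hlow := annulus_lower hκ'd hs hsr hr1
  rw [hvol] at hlow
  set β : ℂ := b * (s : ℂ) ^ 2 with hβ
  set T : ℂ →ₗ[ℝ] ℂ := ((LinearMap.id : ℂ →ₗ[ℝ] ℂ) -
      (LinearMap.mulLeft ℝ β).comp (conjAe.toLinearMap)) with hT
  have hTa : ∀ w, T w = w - β * (starRingEnd ℂ) w := by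
    intro w
    simp [hT]
  have hβn : ‖β‖ = ‖b‖ * s ^ 2 := by
    rw [hβ, norm_mul, norm_pow, norm_real, Real.norm_of_nonneg hs.le]
  have hsub : T '' (h '' A) ⊆ closedBall 0 (s⁻¹ + 4 * N * s ^ 2) := by
    rintro _ ⟨_, ⟨z, hz, rfl⟩, rfl⟩
    have hz' : s ≤ ‖z‖ ∧ ‖z‖ ≤ r := hz
    rw [mem_closedBall_zero_iff, hTa]
    exact ellipse_bound hs hz'.1 (by linarith) rfl hM0
      (hrem z (by simpa using hz'.2)) hN hs1 hs2
  have hR : 0 ≤ s⁻¹ + 4 * N * s ^ 2 := by positivity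
  have hmeas : MeasureTheory.volume.real (T '' (h '' A)) ≤
      Real.pi * (s⁻¹ + 4 * N * s ^ 2) ^ 2 := by
    have h1 := MeasureTheory.measureReal_mono (μ := MeasureTheory.volume) hsub
      (MeasureTheory.measure_closedBall_lt_top.ne)
    refine h1.trans_eq ?_
    rw [MeasureTheory.measureReal_def, Complex.volume_closedBall]
    simp only [ENNReal.toReal_mul, ENNReal.toReal_pow, ENNReal.toReal_ofReal hR,
      ENNReal.coe_toReal, NNReal.coe_real_pi]
    ring
  have hdet : |LinearMap.det T| = 1 - (‖b‖ * s ^ 2) ^ 2 := by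
    rw [hT, det_conj_lin, hβn, abs_of_nonneg]
    have : ‖b‖ * s ^ 2 ≤ 1 := by nlinarith [norm_nonneg b]
    have h2 : 0 ≤ ‖b‖ * s ^ 2 := by positivity
    nlinarith
  have hTm : MeasureTheory.volume.real (T '' (h '' A)) =
      (1 - (‖b‖ * s ^ 2) ^ 2) * MeasureTheory.volume.real (h '' A) := by
    rw [MeasureTheory.measureReal_def, MeasureTheory.Measure.addHaar_image_linearMap,
      ENNReal.toReal_mul, ENNReal.toReal_ofReal (abs_nonneg _), hdet,
      ← MeasureTheory.measureReal_def]
  have hdet0 : 0 ≤ 1 - (‖b‖ * s ^ 2) ^ 2 := hdet ▸ abs_nonneg _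
  have := mul_le_mul_of_nonneg_left hlow hdet0
  rw [hTm] at hmeas
  have h3 := this.trans hmeas
  have hpi := Real.pi_pos
  refine le_of_mul_le_mul_left ?_ hpi
  refine le_trans (le_of_eq ?_) h3
  ring

theorem area_thm {κ : ℂ → ℂ} (hκ : DifferentiableOn ℂ κ (ball 0 1)) (h0 : κ 0 = 0)
    (hinj : InjOn (fun z => z⁻¹ + κ z) (ball 0 1 \ {0})) : ‖deriv κ 0‖ ≤ 1 := by
  set D := ‖deriv κ 0‖ with hD
  have hD0 : 0 ≤ D := norm_nonneg _
  have key : ∀ r : ℝ, 0 < r → r < 1 → D ^ 2 * r ^ 2 - (r ^ 2)⁻¹ ≤ 0 := by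
    intro r hr0 hr1
    obtain ⟨N, hN, H⟩ := area_ineq hκ h0 hinj hr0 hr1
    set E : ℝ → ℝ := fun s => 8 * N * s + 16 * N ^ 2 * s ^ 4 + D ^ 2 * s ^ 2 + D ^ 2 * s ^ 2
      + D ^ 2 * s ^ 4 * (- (r ^ 2)⁻¹ + D ^ 2 * (r ^ 2 - s ^ 2)) with hE
    have hEc : Continuous E := by fun_prop
    have hE0 : Tendsto E (nhdsWithin 0 (Ioi 0)) (nhds 0) := by
      have := (hEc.tendsto 0).mono_left (nhdsWithin_le_nhds (s := Ioi 0))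
      simpa [hE] using this
    refine ge_of_tendsto hE0 ?_
    have hc1 : Continuous fun s : ℝ => 4 * D * s := by fun_prop
    have hc2 : Continuous fun s : ℝ => 4 * N * s := by fun_prop
    have hv1 : ∀ᶠ s in nhdsWithin (0:ℝ) (Ioi 0), 4 * D * s < 1 :=
      (hc1.tendsto 0).eventually_lt_const (by simp) |>.filter_mono nhdsWithin_le_nhds
    have hv2 : ∀ᶠ s in nhdsWithin (0:ℝ) (Ioi 0), 4 * N * s < 1 :=
      (hc2.tendsto 0).eventually_lt_const (by simp) |>.filter_mono nhdsWithin_le_nhds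
    have hv3 : ∀ᶠ s in nhdsWithin (0:ℝ) (Ioi 0), s < r :=
      (eventually_lt_nhds hr0).filter_mono nhdsWithin_le_nhds
    filter_upwards [hv1, hv2, hv3, self_mem_nhdsWithin] with s h1 h2 h3 h4
    have hs : 0 < s := h4
    have := H s hs h3.le h1.le h2.le
    have e1 : (1 - (D * s ^ 2) ^ 2) * (((s ^ 2)⁻¹ - (r ^ 2)⁻¹) + D ^ 2 * (r ^ 2 - s ^ 2)) -
      (s⁻¹ + 4 * N * s ^ 2) ^ 2 = D ^ 2 * r ^ 2 - (r ^ 2)⁻¹ - E s := by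
      simp only [hE]
      field_simp
      ring
    linarith
  have key2 : ∀ r : ℝ, 0 < r → r < 1 → D * r ^ 2 ≤ 1 := by
    intro r h1 h2
    have := key r h1 h2
    have h3 : D ^ 2 * r ^ 2 ≤ (r ^ 2)⁻¹ := by linarith
    rw [← one_div, le_div_iff₀ (by positivity)] at h3
    have h4 : (D * r ^ 2) ^ 2 ≤ 1 ^ 2 := by nlinarith
    exact (le_abs_self _).trans (abs_le_of_sq_le_sq h4 zero_le_one)
  have hcont : Continuous fun r : ℝ => D * r ^ 2 := by fun_prop
  have hlim : Tendsto (fun r : ℝ => D * r ^ 2) (nhdsWithin 1 (Iio 1)) (nhds D) := by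
    have := (hcont.tendsto 1).mono_left (nhdsWithin_le_nhds (s := Iio 1))
    simpa using this
  refine le_of_tendsto hlim ?_
  filter_upwards [self_mem_nhdsWithin,
    (eventually_gt_nhds (zero_lt_one (α := ℝ))).filter_mono nhdsWithin_le_nhds] with r h1 h2
  exact key2 r h2 h1

theorem exists_log_ball {φ : ℂ → ℂ} (hφ : DifferentiableOn ℂ φ (ball 0 1))
    (hne : ∀ z ∈ ball (0:ℂ) 1, φ z ≠ 0) (h1 : φ 0 = 1) :
    ∃ L : ℂ → ℂ, DifferentiableOn ℂ L (ball 0 1) ∧ L 0 = 0 ∧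
      ∀ z ∈ ball (0:ℂ) 1, exp (L z) = φ z := by
  have hd : DifferentiableOn ℂ (fun z => deriv φ z / φ z) (ball 0 1) :=
    (hφ.deriv isOpen_ball).div hφ hne
  obtain ⟨L, hL0, hL⟩ := hd.isExactOn_ball.with_val_at 0 0
  have hLd : DifferentiableOn ℂ L (ball 0 1) := fun z hz =>
    (hL z hz).differentiableAt.differentiableWithinAt
  refine ⟨L, hLd, hL0, ?_⟩
  have hder : ∀ z ∈ ball (0:ℂ) 1, HasDerivAt (fun z => φ z * exp (-L z)) 0 z := by
    intro z hz
    have a := (hφ.differentiableAt (isOpen_ball.mem_nhds hz)).hasDerivAt.mul (hL z hz).neg.cexp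
    refine a.congr_deriv ?_
    have := hne z hz
    field_simp
    ring
  have hconst : ∀ z ∈ ball (0:ℂ) 1, φ z * exp (-L z) = 1 := by
    intro z hz
    have := (convex_ball (0:ℂ) 1).is_const_of_fderivWithin_eq_zero (𝕜 := ℂ)
      (f := fun z => φ z * exp (-L z))
      (fun z hz => (hder z hz).differentiableAt.differentiableWithinAt) ?_ hz
      (mem_ball_self one_pos)
    · rw [this, h1, hL0]
      simp
    · intro y hy
      rw [fderivWithin_of_isOpen isOpen_ball hy]
      ext
      have := (hder y hy).deriv
      simpa using this
  intro z hz
  have := hconst z hz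
  rw [exp_neg] at this
  have h2 := exp_ne_zero (L z)
  field_simp at this
  exact this.symm

theorem bieberbach {F : ℂ → ℂ} (hF : DifferentiableOn ℂ F (ball 0 1))
    (hi : InjOn F (ball 0 1)) : ‖deriv (deriv F) 0‖ ≤ 4 * ‖deriv F 0‖ := by
  have h00 : (0:ℂ) ∈ ball (0:ℂ) 1 := mem_ball_self one_pos
  have hnh : ball (0:ℂ) 1 ∈ nhds (0:ℂ) := ball_mem_nhds 0 one_pos
  set c := deriv F 0 with hc
  have hc0 : c ≠ 0 := inj_deriv_ne_zero isOpen_ball hF hi h00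
  set φ : ℂ → ℂ := fun z => dslope F 0 z / c with hφ
  have hφd : DifferentiableOn ℂ φ (ball 0 1) :=
    ((Complex.differentiableOn_dslope hnh).2 hF).div_const c
  have hFφ : ∀ z, F z = F 0 + c * (z * φ z) := by
    intro z
    have := sub_smul_dslope F 0 z
    simp only [sub_zero, smul_eq_mul] at this
    simp only [hφ]
    field_simp
    rw [this]
    ring
  have hφ0 : φ 0 = 1 := by
    simp only [hφ, dslope_same]
    exact div_self hc0
  have hφne : ∀ z ∈ ball (0:ℂ) 1, φ z ≠ 0 := by
    intro z hz h
    by_cases hz0 : z = 0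
    · rw [hz0, hφ0] at h
      exact one_ne_zero h
    · have := hFφ z
      rw [h] at this
      exact hz0 (hi hz h00 (by simpa using this))
  obtain ⟨L, hLd, hL0, hL⟩ := exists_log_ball hφd hφne hφ0
  set p : ℂ → ℂ := fun z => exp (-(L z) / 2) with hp
  have hpd : DifferentiableOn ℂ p (ball 0 1) := by
    intro z hz
    have := hLd z hz
    fun_prop
  have hp0 : p 0 = 1 := by simp [hp, hL0]
  have hpφ : ∀ z ∈ ball (0:ℂ) 1, p z ^ 2 * φ z = 1 := by
    intro z hz
    simp only [hp]
    rw [← hL z hz, ← exp_nat_mul, ← exp_add]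
    push_cast
    ring_nf
    simp
  set k := dslope p 0 with hk
  have hkd : DifferentiableOn ℂ k (ball 0 1) := (Complex.differentiableOn_dslope hnh).2 hpd
  have hpk : ∀ z, p z = 1 + z * k z := by
    intro z
    have := sub_smul_dslope p 0 z
    simp only [sub_zero, smul_eq_mul, hp0] at this
    rw [hk, this]
    ring
  have hsq : MapsTo (fun z : ℂ => z ^ 2) (ball 0 1) (ball 0 1) := by
    intro z hz
    rw [mem_ball_zero_iff] at hz ⊢
    rw [norm_pow]
    exact pow_lt_one₀ (norm_nonneg z) hz two_ne_zero
  set κ : ℂ → ℂ := fun z => z * k (z ^ 2) with hκ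
  have hk2 : DifferentiableOn ℂ (fun z => k (z ^ 2)) (ball 0 1) :=
    hkd.comp (by fun_prop) hsq
  have hκd : DifferentiableOn ℂ κ (ball 0 1) := differentiableOn_id.mul hk2
  have hκ0 : κ 0 = 0 := by simp [hκ]
  have hh : ∀ z ≠ 0, z⁻¹ + κ z = z⁻¹ * p (z ^ 2) := by
    intro z hz
    rw [hpk]
    simp only [hκ]
    field_simp
  have hinj : InjOn (fun z => z⁻¹ + κ z) (ball 0 1 \ {0}) := by
    rintro z ⟨hz, hz0⟩ w ⟨hw, hw0⟩ hzw
    have hz0' : z ≠ 0 := hz0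
    have hw0' : w ≠ 0 := hw0
    simp only [hh z hz0', hh w hw0'] at hzw
    have e1 := hpφ _ (hsq hz)
    have e2 := hpφ _ (hsq hw)
    simp only at e1 e2
    have e3 : (z⁻¹ * p (z ^ 2)) ^ 2 * (z ^ 2 * φ (z ^ 2)) = 1 := by
      rw [← e1]
      field_simp
    have e4 : (z⁻¹ * p (z ^ 2)) ^ 2 * (w ^ 2 * φ (w ^ 2)) = 1 := by
      rw [hzw, ← e2]
      field_simp
    have hne : (z⁻¹ * p (z ^ 2)) ^ 2 ≠ 0 := left_ne_zero_of_mul_eq_one e3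
    have e5 : z ^ 2 * φ (z ^ 2) = w ^ 2 * φ (w ^ 2) := mul_left_cancel₀ hne (e3.trans e4.symm)
    have e6 : F (z ^ 2) = F (w ^ 2) := by rw [hFφ (z ^ 2), hFφ (w ^ 2), e5]
    have e7 : z ^ 2 = w ^ 2 := hi (hsq hz) (hsq hw) e6
    rcases sq_eq_sq_iff_eq_or_eq_neg.1 e7 with h | h
    · exact h
    · exfalso
      rw [← e7] at hzw
      have hpne : p (z ^ 2) ≠ 0 := exp_ne_zero _
      have e8 := mul_right_cancel₀ hpne hzw
      rw [h, inv_neg, neg_eq_iff_add_eq_zero, ← two_mul] at e8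
      simp [hw0'] at e8
  have harea := area_thm hκd hκ0 hinj
  have hκ' : deriv κ 0 = deriv p 0 := by
    have a : HasDerivAt κ (1 * k (0 ^ 2) + 0 * deriv (fun z => k (z ^ 2)) 0) 0 :=
      (hasDerivAt_id (0:ℂ)).mul (hk2.differentiableAt hnh).hasDerivAt
    rw [a.deriv, hk]
    simp
  have hL' := (hLd.differentiableAt hnh).hasDerivAt
  have hp' : deriv p 0 = -(deriv L 0) / 2 := by
    have a := (hL'.neg.div_const 2).cexp
    have b : HasDerivAt p (p 0 * (-(deriv L 0) / 2)) 0 := a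
    rw [b.deriv, hp0, one_mul]
  have hφ' : deriv φ 0 = deriv L 0 := by
    have a : HasDerivAt φ (exp (L 0) * deriv L 0) 0 := by
      refine hL'.cexp.congr_of_eventuallyEq ?_
      filter_upwards [hnh] with z hz using (hL z hz).symm
    rw [a.deriv, hL0]
    simp
  have hF'' : deriv (deriv F) 0 = c * (2 * deriv φ 0) := by
    have a : ∀ z ∈ ball (0:ℂ) 1, deriv F z = c * (φ z + z * deriv φ z) := by
      intro z hz
      have b := (((hasDerivAt_id z).mul
        (hφd.differentiableAt (isOpen_ball.mem_nhds hz)).hasDerivAt).const_mul c).const_add (F 0)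
      have b2 : HasDerivAt F (c * (1 * φ z + z * deriv φ z)) z := by
        refine b.congr_of_eventuallyEq (Eventually.of_forall fun w => ?_)
        exact hFφ w
      rw [b2.deriv, one_mul]
    have hφ2 := ((hφd.deriv isOpen_ball).differentiableAt hnh).hasDerivAt
    have b := ((hφd.differentiableAt hnh).hasDerivAt.add ((hasDerivAt_id (0:ℂ)).mul hφ2)).const_mul c
    have b2 : HasDerivAt (deriv F) (c * (deriv φ 0 + (1 * deriv φ 0 + 0 * deriv (deriv φ) 0))) 0 := by
      refine b.congr_of_eventuallyEq ?_
      filter_upwards [hnh] with z hz using a z hz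
    rw [b2.deriv]
    ring
  rw [hκ', hp', norm_div, norm_neg] at harea
  rw [hF'', hφ', norm_mul, norm_mul]
  simp only [RCLike.norm_ofNat] at harea ⊢
  have : ‖deriv L 0‖ ≤ 2 := by linarith
  nlinarith [norm_nonneg c]

/-- Koebe one-quarter theorem. -/
theorem koebe_quarter {F : ℂ → ℂ} (hF : DifferentiableOn ℂ F (ball 0 1))
    (hi : InjOn F (ball 0 1)) {w : ℂ} (hw : ∀ z ∈ ball (0:ℂ) 1, F z ≠ w) :
    ‖deriv F 0‖ ≤ 4 * ‖F 0 - w‖ := by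
  have h00 : (0:ℂ) ∈ ball (0:ℂ) 1 := mem_ball_self one_pos
  have hnh : ball (0:ℂ) 1 ∈ nhds (0:ℂ) := ball_mem_nhds 0 one_pos
  have hB := bieberbach hF hi
  have hne : ∀ z ∈ ball (0:ℂ) 1, F z - w ≠ 0 := fun z hz => sub_ne_zero.2 (hw z hz)
  set G : ℂ → ℂ := fun z => (F z - w)⁻¹ with hG
  have hGd : DifferentiableOn ℂ G (ball 0 1) := (hF.sub_const w).inv hne
  have hGi : InjOn G (ball 0 1) := by
    intro x hx y hy hxy
    have := inv_injective hxy
    exact hi hx hy (sub_left_injective this)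
  have hGB := bieberbach hGd hGi
  have hFd : ∀ z ∈ ball (0:ℂ) 1, HasDerivAt F (deriv F z) z := fun z hz =>
    (hF.differentiableAt (isOpen_ball.mem_nhds hz)).hasDerivAt
  have hG' : ∀ z ∈ ball (0:ℂ) 1, deriv G z = -deriv F z / (F z - w) ^ 2 := fun z hz =>
    (((hFd z hz).sub_const w).inv (hne z hz)).deriv
  have hF2 := ((hF.deriv isOpen_ball).differentiableAt hnh).hasDerivAt
  have hG2 : deriv (deriv G) 0 =
      (-(deriv (deriv F) 0) + 2 * deriv F 0 ^ 2 / (F 0 - w)) / (F 0 - w) ^ 2 := by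
    have a := hF2.neg.div (((hFd 0 h00).sub_const w).pow 2) (pow_ne_zero 2 (hne 0 h00))
    have heq : deriv G =ᶠ[nhds 0] (-deriv F / (fun x => F x - w) ^ 2) := by
      filter_upwards [hnh] with z hz using hG' z hz
    have b := a.congr_of_eventuallyEq heq
    rw [b.deriv]
    have := hne 0 h00
    simp only [Pi.neg_apply, Pi.pow_apply]
    push_cast
    field_simp
    ring
  rw [hG2, hG' 0 h00] at hGB
  set d := F 0 - w with hd
  have hd0 : d ≠ 0 := hne 0 h00
  have hdn : 0 < ‖d‖ := norm_pos_iff.2 hd0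
  have hc0 : 0 < ‖deriv F 0‖ := norm_pos_iff.2 (inj_deriv_ne_zero isOpen_ball hF hi h00)
  rw [norm_div, norm_div, norm_neg, ← mul_div_assoc, div_le_div_iff_of_pos_right
    (norm_pos_iff.2 (pow_ne_zero 2 hd0))] at hGB
  have h1 : ‖2 * deriv F 0 ^ 2 / d‖ ≤ 8 * ‖deriv F 0‖ := by
    calc ‖2 * deriv F 0 ^ 2 / d‖ =
        ‖(-(deriv (deriv F) 0) + 2 * deriv F 0 ^ 2 / d) + deriv (deriv F) 0‖ := by
          congr 1
          ring
      _ ≤ _ := norm_add_le _ _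
      _ ≤ 8 * ‖deriv F 0‖ := by linarith
  rw [norm_div, norm_mul, norm_pow, div_le_iff₀ hdn] at h1
  simp only [RCLike.norm_ofNat] at h1
  refine le_of_mul_le_mul_left ?_ hc0
  nlinarith

theorem isOpen_UHP : IsOpen UHP := isOpen_lt continuous_const continuous_im

/-- The Cayley-type map from the disc onto the upper half-plane, sending `0` to `z`. -/
def cay (z ζ : ℂ) : ℂ := z.re + I * z.im * ((1 + ζ) / (1 - ζ))

theorem one_sub_ne {ζ : ℂ} (h : ζ ∈ ball (0:ℂ) 1) : 1 - ζ ≠ 0 := by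
  intro h0
  have : ζ = 1 := (sub_eq_zero.1 h0).symm
  rw [this] at h
  simp at h

theorem cay_zero (z : ℂ) : cay z 0 = z := by
  simp only [cay, add_zero, sub_zero, div_one, mul_one]
  rw [mul_comm I, re_add_im]

theorem cay_hasDerivAt (z : ℂ) {ζ : ℂ} (h : ζ ∈ ball (0:ℂ) 1) :
    HasDerivAt (cay z) (2 * I * z.im / (1 - ζ) ^ 2) ζ := by
  have hne := one_sub_ne h
  have a := (((hasDerivAt_id ζ).const_add 1).div ((hasDerivAt_id ζ).const_sub 1) hne).const_mul
    (I * z.im) |>.const_add (z.re : ℂ)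
  refine HasDerivAt.congr_deriv (f := cay z) a ?_
  simp only [id]
  field_simp
  ring

theorem cay_mem {z : ℂ} (hz : z ∈ UHP) {ζ : ℂ} (h : ζ ∈ ball (0:ℂ) 1) : cay z ζ ∈ UHP := by
  have hz' : 0 < z.im := hz
  have hne := one_sub_ne h
  have hn : 0 < normSq (1 - ζ) := normSq_pos.2 hne
  have e : (cay z ζ).im = z.im * ((1 - normSq ζ) / normSq (1 - ζ)) := by
    have e1 : (cay z ζ).im = z.im * ((1 + ζ) / (1 - ζ)).re := by
      simp [cay]
    rw [e1, div_re]
    simp only [normSq_apply] at hn ⊢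
    simp only [add_re, one_re, sub_re, add_im, one_im, sub_im] at hn ⊢
    field_simp
    ring
  change 0 < (cay z ζ).im
  rw [e]
  have h1 : normSq ζ < 1 := by
    rw [normSq_eq_norm_sq]
    rw [mem_ball_zero_iff] at h
    exact pow_lt_one₀ (norm_nonneg _) h two_ne_zero
  have : 0 < 1 - normSq ζ := by linarith
  positivity

theorem cay_injOn {z : ℂ} (hz : z ∈ UHP) : InjOn (cay z) (ball 0 1) := by
  intro a ha b hb hab
  have hz' : (z.im : ℂ) ≠ 0 := by exact_mod_cast (ne_of_gt hz)
  have h1 := one_sub_ne ha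
  have h2 := one_sub_ne hb
  simp only [cay] at hab
  have h3 := mul_left_cancel₀ (mul_ne_zero I_ne_zero hz') (add_left_cancel hab)
  rw [div_eq_div_iff h1 h2] at h3
  linear_combination h3 / 2

theorem cay_comp {f : ℂ → ℂ} (hf : DifferentiableOn ℂ f UHP) (hi : InjOn f UHP) {z : ℂ}
    (hz : z ∈ UHP) : DifferentiableOn ℂ (f ∘ cay z) (ball 0 1) ∧ InjOn (f ∘ cay z) (ball 0 1) ∧
      deriv (f ∘ cay z) 0 = deriv f z * (2 * I * z.im) ∧
      deriv (deriv (f ∘ cay z)) 0 =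
        deriv (deriv f) z * (2 * I * z.im) ^ 2 + deriv f z * (4 * I * z.im) := by
  have h00 : (0:ℂ) ∈ ball (0:ℂ) 1 := mem_ball_self one_pos
  have hnh : ball (0:ℂ) 1 ∈ nhds (0:ℂ) := ball_mem_nhds 0 one_pos
  have hd : ∀ ζ ∈ ball (0:ℂ) 1, HasDerivAt (f ∘ cay z)
      (deriv f (cay z ζ) * (2 * I * z.im / (1 - ζ) ^ 2)) ζ := fun ζ hζ =>
    ((hf.differentiableAt (isOpen_UHP.mem_nhds (cay_mem hz hζ))).hasDerivAt).comp ζ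
      (cay_hasDerivAt z hζ)
  refine ⟨fun ζ hζ => (hd ζ hζ).differentiableAt.differentiableWithinAt,
    hi.comp (cay_injOn hz) fun ζ hζ => cay_mem hz hζ, ?_, ?_⟩
  · rw [(hd 0 h00).deriv, cay_zero]
    simp
  · have a1 : HasDerivAt (fun ζ => deriv f (cay z ζ))
        (deriv (deriv f) z * (2 * I * z.im / (1 - 0) ^ 2)) 0 := by
      have b : HasDerivAt (deriv f) (deriv (deriv f) z) (cay z 0) := by
        rw [cay_zero]
        exact ((hf.deriv isOpen_UHP).differentiableAt (isOpen_UHP.mem_nhds hz)).hasDerivAt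
      exact b.comp 0 (cay_hasDerivAt z h00)
    have a2 : HasDerivAt (fun ζ : ℂ => 2 * I * z.im / (1 - ζ) ^ 2) (4 * I * z.im) 0 := by
      have b := (hasDerivAt_const (0:ℂ) (2 * I * (z.im : ℂ))).div
        (((hasDerivAt_id (0:ℂ)).const_sub 1).pow 2) (by simp)
      refine HasDerivAt.congr_deriv (f := fun ζ : ℂ => 2 * I * z.im / (1 - ζ) ^ 2) b ?_
      simp
      ring
    have heq : deriv (f ∘ cay z) =ᶠ[nhds 0]
        fun ζ => deriv f (cay z ζ) * (2 * I * z.im / (1 - ζ) ^ 2) := by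
      filter_upwards [hnh] with ζ hζ using (hd ζ hζ).deriv
    rw [((a1.mul a2).congr_of_eventuallyEq heq).deriv, cay_zero]
    simp
    ring

theorem uhp_bieberbach {f : ℂ → ℂ} (hf : DifferentiableOn ℂ f UHP) (hi : InjOn f UHP) {z : ℂ}
    (hz : z ∈ UHP) :
    z.im * ((starRingEnd ℂ) (deriv f z) * (I * deriv (deriv f) z)).re ≤ ‖deriv f z‖ ^ 2 := by
  obtain ⟨h1, h2, h3, h4⟩ := cay_comp hf hi hz
  have hz' : 0 < z.im := hz
  have hB := bieberbach h1 h2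
  rw [h3, h4] at hB
  set u := deriv f z
  set v := deriv (deriv f) z
  have e1 : v * (2 * I * z.im) ^ 2 + u * (4 * I * z.im) = (4 * z.im : ℝ) * (I * (u + I * z.im * v)) := by
    push_cast
    ring
  rw [e1, norm_mul, norm_mul, norm_mul, norm_mul, norm_mul, norm_real, norm_real, norm_I,
    Real.norm_of_nonneg (by positivity), Real.norm_of_nonneg hz'.le] at hB
  simp only [RCLike.norm_ofNat] at hB
  have h5 : ‖u + I * z.im * v‖ ≤ 2 * ‖u‖ := by nlinarith
  have h6 : ((starRingEnd ℂ) u * (u + I * z.im * v)).re ≤ ‖u‖ * (2 * ‖u‖) := by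
    refine (re_le_norm _).trans ?_
    rw [norm_mul, RCLike.norm_conj]
    gcongr
  have h7 : ((starRingEnd ℂ) u * (u + I * z.im * v)).re =
      ‖u‖ ^ 2 + z.im * ((starRingEnd ℂ) u * (I * v)).re := by
    rw [← normSq_eq_norm_sq, normSq_apply]
    simp
    ring
  nlinarith

theorem uhp_quarter {f : ℂ → ℂ} (hf : DifferentiableOn ℂ f UHP) (hi : InjOn f UHP) {z : ℂ}
    (hz : z ∈ UHP) {w : ℂ} (hw : w ∉ f '' UHP) : z.im * ‖deriv f z‖ ≤ 2 * ‖f z - w‖ := by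
  obtain ⟨h1, h2, h3, h4⟩ := cay_comp hf hi hz
  have hz' : 0 < z.im := hz
  have := koebe_quarter h1 h2 (w := w) fun ζ hζ h => hw ⟨cay z ζ, cay_mem hz hζ, h⟩
  rw [h3, norm_mul, norm_mul, norm_mul, norm_real, norm_I, Real.norm_of_nonneg hz'.le,
    comp_apply, cay_zero] at this
  simp only [RCLike.norm_ofNat] at this
  linarith

theorem uhp_mono {f : ℂ → ℂ} (hf : DifferentiableOn ℂ f UHP) (hi : InjOn f UHP) (x : ℝ)
    {y y₀ : ℝ} (hy : 0 < y) (hyy : y ≤ y₀) :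
    ‖deriv f (x + y₀ * I)‖ / y₀ ≤ ‖deriv f (x + y * I)‖ / y := by
  have hmem : ∀ t : ℝ, 0 < t → ((x : ℂ) + t * I) ∈ UHP := by
    intro t ht
    change 0 < ((x : ℂ) + t * I).im
    simpa using ht
  set m : ℝ → ℝ := fun t => ‖deriv f (x + t * I)‖ ^ 2 / t ^ 2 with hm
  have hder : ∀ t : ℝ, 0 < t → HasDerivAt m
      ((2 * inner ℝ (deriv f (x + t * I)) (deriv (deriv f) (x + t * I) * I) * t ^ 2 -
        ‖deriv f (x + t * I)‖ ^ 2 * (2 * t)) / (t ^ 2) ^ 2) t := by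
    intro t ht
    have a1 : HasDerivAt (fun t : ℝ => (x : ℂ) + t * I) I t := by
      have := ((hasDerivAt_id t).ofReal_comp.mul_const I).const_add (x : ℂ)
      simpa using this
    have a2 : HasDerivAt (fun t : ℝ => deriv f (x + t * I)) (deriv (deriv f) (x + t * I) * I) t :=
      HasDerivAt.comp (h₂ := deriv f) t ((hf.deriv isOpen_UHP).differentiableAt
        (isOpen_UHP.mem_nhds (hmem t ht))).hasDerivAt a1
    have a3 : HasDerivAt (fun t : ℝ => t ^ 2) (2 * t) t := by simpa using hasDerivAt_pow 2 t
    exact a2.norm_sq.div a3 (by positivity)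
  have hanti : AntitoneOn m (Ioi 0) := by
    apply antitoneOn_of_deriv_nonpos (convex_Ioi 0)
    · intro t ht
      exact (hder t ht).continuousAt.continuousWithinAt
    · intro t ht
      rw [interior_Ioi] at ht
      exact (hder t ht).differentiableAt.differentiableWithinAt
    · intro t ht
      rw [interior_Ioi] at ht
      have ht' : 0 < t := ht
      rw [(hder t ht).deriv]
      have hb := uhp_bieberbach hf hi (hmem t ht)
      have e : inner ℝ (deriv f (x + t * I)) (deriv (deriv f) (x + t * I) * I) =
          ((starRingEnd ℂ) (deriv f (x + t * I)) * (I * deriv (deriv f) (x + t * I))).re := by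
        rw [Complex.inner]
        congr 1
        ring
      have e2 : ((x : ℂ) + t * I).im = t := by simp
      rw [e2, ← e] at hb
      apply div_nonpos_of_nonpos_of_nonneg _ (by positivity)
      nlinarith
  have := hanti (mem_Ioi.2 hy) (mem_Ioi.2 (hy.trans_le hyy)) hyy
  simp only [hm, ← div_pow] at this
  have hy0 : 0 < y₀ := hy.trans_le hyy
  exact (pow_le_pow_iff_left₀ (by positivity) (by positivity) two_ne_zero).1 this

theorem hydro_im_ge {f : ℂ → ℂ} (hf : DifferentiableOn ℂ f UHP)
    (hm : ∀ z ∈ UHP, 0 < (f z).im)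
    (ht : Tendsto (fun z => f z - z) (cobounded ℂ ⊓ 𝓟 UHP) (nhds (0 : ℂ)))
    {z : ℂ} (hz : z ∈ UHP) : z.im ≤ (f z).im := by
  have hz' : 0 < z.im := hz
  refine le_of_forall_pos_le_add fun ε hε => ?_
  have h1 := (Metric.tendsto_nhds.1 ht) ε hε
  rw [eventually_inf_principal] at h1
  rw [← comap_norm_atTop, eventually_comap] at h1
  obtain ⟨R, hR⟩ := eventually_atTop.1 h1
  set η := min ε (z.im / 2) with hη
  have hη0 : 0 < η := lt_min hε (by linarith)
  have hηε : η ≤ ε := min_le_left _ _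
  have hηz : η < z.im := (min_le_right _ _).trans_lt (by linarith)
  set R' := max R (‖z‖ + 1) with hR'
  set U : Set ℂ := {w | η < w.im} ∩ ball 0 R' with hU
  have hUo : IsOpen U := (isOpen_lt continuous_const continuous_im).inter isOpen_ball
  have hcl : closure U ⊆ {w | η ≤ w.im} ∩ closedBall 0 R' := by
    apply closure_minimal
    · rintro w ⟨h1, h2⟩
      exact ⟨show η ≤ w.im from le_of_lt (show η < w.im from h1), ball_subset_closedBall h2⟩
    · exact (isClosed_le continuous_const continuous_im).inter isClosed_closedBall
  have hsub : closure U ⊆ UHP := fun w hw => hη0.trans_le (hcl hw).1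
  have hd : DifferentiableOn ℂ (fun w => cexp (I * (f w - w))) UHP :=
    ((hf.sub differentiableOn_id).const_mul I).cexp
  have hnorm : ∀ w, ‖cexp (I * (f w - w))‖ = Real.exp (w.im - (f w).im) := by
    intro w
    rw [norm_exp]
    simp
  have hzU : z ∈ U := ⟨hηz, by
    rw [mem_ball_zero_iff]
    exact (lt_add_one _).trans_le (le_max_right _ _)⟩
  have key := norm_le_of_forall_mem_frontier_norm_le (U := U) (C := Real.exp ε)
    (isBounded_ball.subset inter_subset_right)
    (hd.mono hsub).diffContOnCl (fun w hw => ?_) (subset_closure hzU)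
  · rw [hnorm, Real.exp_le_exp] at key
    linarith
  · rw [hnorm, Real.exp_le_exp]
    rw [frontier, hUo.interior_eq] at hw
    have hwU := hsub hw.1
    have hw1 := hcl hw.1
    by_cases hc : η < w.im
    · have hn : R' ≤ ‖w‖ := by
        by_contra hlt
        exact hw.2 ⟨hc, by rw [mem_ball_zero_iff]; exact not_le.1 hlt⟩
      have h2 := hR ‖w‖ ((le_max_left _ _).trans hn) w rfl hwU
      rw [dist_zero_right] at h2
      have h3 := (abs_le.1 (abs_im_le_norm (f w - w))).1
      rw [sub_im] at h3
      linarith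
    · have := hm w hwU
      linarith

theorem hull_im_le {K : Set ℂ} (hK : IsHull K) {k : ℂ} (hk : k ∈ K) : k.im ≤ Metric.diam K := by
  obtain ⟨hb, hsub, ho, -, hs⟩ := hK
  by_contra hlt
  rw [not_le] at hlt
  obtain ⟨r, hr1, hr2⟩ := exists_between hlt
  have hr0 : 0 < r := diam_nonneg.trans_lt hr1
  have hdist : ∀ θ : ℝ, dist (k + r * cexp (θ * I)) k = r := by
    intro θ
    rw [dist_eq_norm, add_sub_cancel_left, norm_mul, norm_exp_ofReal_mul_I, mul_one, norm_real,
      Real.norm_of_nonneg hr0.le]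
  have hmem : ∀ θ : ℝ, k + r * cexp (θ * I) ∈ UHP \ K := by
    intro θ
    constructor
    · change 0 < (k + r * cexp (θ * I)).im
      have h := hdist θ
      rw [dist_eq_norm] at h
      have h2 := (abs_le.1 (abs_im_le_norm (k + r * cexp (θ * I) - k))).1
      rw [h, sub_im] at h2
      linarith
    · intro hin
      have := dist_le_diam_of_mem hb hin hk
      rw [hdist] at this
      linarith
  obtain ⟨L, hLc, hL⟩ := exists_continuousOn_eqOn_exp_comp (U := UHP \ K) hs ho
    (g := fun w => w - k) (by fun_prop) (by
      rintro ⟨w, hw, h0⟩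
      rw [sub_eq_zero.1 h0] at hw
      exact hw.2 hk)
  have hc1 : Continuous fun θ : ℝ => L (k + r * cexp (θ * I)) :=
    hLc.comp_continuous (by fun_prop) hmem
  have hc2 : Continuous fun θ : ℝ => (L (k + r * cexp (θ * I))).im - θ :=
    (continuous_im.comp hc1).sub continuous_id
  have hexp : ∀ θ : ℝ, cexp (L (k + r * cexp (θ * I)) - θ * I) = r := by
    intro θ
    have h := hL (hmem θ)
    simp only [comp_apply, add_sub_cancel_left] at h
    rw [Complex.exp_sub, h, mul_div_assoc, div_self (Complex.exp_ne_zero _), mul_one]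
  have hre : ∀ θ : ℝ, Real.exp (L (k + r * cexp (θ * I)) - θ * I).re *
      Real.cos ((L (k + r * cexp (θ * I))).im - θ) = r := by
    intro θ
    have h := congrArg re (hexp θ)
    rw [Complex.exp_re, ofReal_re] at h
    simpa using h
  have h2π : cexp (((2 * Real.pi : ℝ) : ℂ) * I) = cexp (((0 : ℝ) : ℂ) * I) := by
    push_cast
    rw [Complex.exp_two_pi_mul_I]
    simp
  set h : ℝ → ℝ := fun θ => (L (k + r * cexp (θ * I))).im - θ with hh
  have hend : h (2 * Real.pi) = h 0 - 2 * Real.pi := by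
    simp only [hh, h2π]
    ring
  have hivt := intermediate_value_Icc' (by positivity : (0:ℝ) ≤ 2 * Real.pi)
    (hc2.continuousOn (s := Icc 0 (2 * Real.pi)))
  have hpi := Real.pi_pos
  obtain ⟨θ, -, hθ⟩ := hivt (show h 0 - Real.pi ∈ Icc (h (2 * Real.pi)) (h 0) from
    ⟨by rw [hend]; linarith, by linarith⟩)
  have e1 := hre 0
  have e2 := hre θ
  change _ * Real.cos (h 0) = r at e1
  change _ * Real.cos (h θ) = r at e2
  have hθ' : h θ = h 0 - Real.pi := hθ
  rw [hθ', Real.cos_sub_pi] at e2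
  have p1 : 0 < Real.cos (h 0) := by
    by_contra hn
    have := mul_nonpos_of_nonneg_of_nonpos
      (Real.exp_pos (L (k + r * cexp ((0:ℝ) * I)) - (0:ℝ) * I).re).le (not_lt.1 hn)
    linarith
  have := mul_pos (Real.exp_pos (L (k + r * cexp (θ * I)) - θ * I).re) p1
  linarith

theorem norm_cayley_le {a b : ℂ} (ha : 0 < a.im) (hb : 0 < b.im) :
    ‖(a - b) / (a - (starRingEnd ℂ) b)‖ ≤ 1 := by
  rw [norm_div]
  apply div_le_one_of_le₀ _ (norm_nonneg _)
  rw [← abs_norm, ← abs_norm (a - (starRingEnd ℂ) b), ← sq_le_sq, ← normSq_eq_norm_sq,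
    ← normSq_eq_norm_sq, normSq_apply, normSq_apply]
  simp only [sub_re, sub_im, conj_re, conj_im]
  nlinarith [mul_pos ha hb]

theorem far_deriv {f : ℂ → ℂ} (hf : DifferentiableOn ℂ f UHP) (hi : InjOn f UHP) {z : ℂ}
    (hz : z ∈ UHP) {ρ : ℝ} (hρ : 0 < ρ) (hball : ball (f z) ρ ⊆ f '' UHP) :
    ρ ≤ 2 * z.im * ‖deriv f z‖ := by
  have hz' : 0 < z.im := hz
  set g := invFunOn f UHP with hgdef
  have hg : ∀ z ∈ UHP, g (f z) = z := fun w hw => hi.leftInvOn_invFunOn hw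
  have hden : ∀ w ∈ UHP, w - (starRingEnd ℂ) z ≠ 0 := by
    intro w hw h0
    have := congrArg im h0
    rw [sub_im, conj_im, zero_im] at this
    have hw' : 0 < w.im := hw
    linarith
  have hgm : ∀ w ∈ ball (f z) ρ, g w ∈ UHP := by
    intro w hw
    obtain ⟨u, hu, rfl⟩ := hball hw
    rw [hg u hu]
    exact hu
  have hgd : ∀ w ∈ ball (f z) ρ, DifferentiableAt ℂ g w := by
    intro w hw
    obtain ⟨u, hu, rfl⟩ := hball hw
    exact inj_inv_differentiableAt isOpen_UHP hf hi hg hu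
  set F : ℂ → ℂ := fun w => (g w - z) / (g w - (starRingEnd ℂ) z) with hF
  have hF0 : F (f z) = 0 := by simp [hF, hg z hz]
  have hS := norm_deriv_le_div_of_mapsTo_ball (f := F) (c := f z) (R₁ := ρ) (R₂ := 1)
    (fun w hw => (((hgd w hw).sub_const z).div ((hgd w hw).sub_const _)
      (hden _ (hgm w hw))).differentiableWithinAt)
    (fun w hw => by
      rw [hF0, mem_closedBall_zero_iff]
      exact norm_cayley_le (hgm w hw) hz) hρ
  have h0 := hgd (f z) (mem_ball_self hρ)
  have hFd : HasDerivAt F (deriv g (f z) / (z - (starRingEnd ℂ) z)) (f z) := by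
    have a := (h0.hasDerivAt.sub_const z).div (h0.hasDerivAt.sub_const ((starRingEnd ℂ) z))
      (hden _ (hgm _ (mem_ball_self hρ)))
    refine HasDerivAt.congr_deriv (f := F) a ?_
    rw [hg z hz]
    have := hden z hz
    field_simp
    ring
  have hm := inj_deriv_mul isOpen_UHP hf hi hg hz
  have hsub : ‖z - (starRingEnd ℂ) z‖ = 2 * z.im := by
    rw [Complex.sub_conj]
    simp [abs_of_pos hz']
  rw [hFd.deriv, norm_div, hsub, div_le_div_iff₀ (by linarith) hρ, one_mul] at hS
  have hm' : ‖deriv g (f z)‖ * ‖deriv f z‖ = 1 := by rw [← norm_mul, hm, norm_one]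
  calc ρ = ‖deriv g (f z)‖ * ρ * ‖deriv f z‖ := by linear_combination (-ρ) * hm'
    _ ≤ 2 * z.im * ‖deriv f z‖ := by gcongr

/-- **Lemma `neardist`.** There is a universal constant `C` such that for
`z ∈ ℍ` with `Im z ≤ 10 diam K` one has `Im z ≤ C diam K |f'(z)|` and
`(Im z)² ≤ C diam K δ_{ℍ\K}(f z)`. -/
theorem hydro_deriv_near_hull :
    ∃ C > 0, ∀ (K : Set ℂ) (f : ℂ → ℂ), IsHull K → K.Nonempty → IsHydroMap K f →
      ∀ z ∈ UHP, z.im ≤ 10 * Metric.diam K →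
        z.im ≤ C * Metric.diam K * ‖deriv f z‖ ∧
          z.im ^ 2 ≤ C * Metric.diam K * infDist (f z) (frontier (UHP \ K)) := by
  refine ⟨50, by norm_num, ?_⟩
  rintro K f hK - ⟨hf, hi, him, ht⟩ z hz hzd
  have hz' : 0 < z.im := hz
  set d := Metric.diam K with hd
  have hd0 : 0 < d := by linarith
  have hfm : ∀ w ∈ UHP, f w ∈ UHP \ K := fun w hw => him ▸ mem_image_of_mem f hw
  set z₀ : ℂ := z.re + ((10 * d : ℝ) : ℂ) * I with hz₀
  have hz₀im : z₀.im = 10 * d := by simp [hz₀]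
  have hz₀U : z₀ ∈ UHP := by
    change 0 < z₀.im
    rw [hz₀im]
    linarith
  have hfz₀ : 10 * d ≤ (f z₀).im := by
    have := hydro_im_ge hf (fun w hw => (hfm w hw).1) ht hz₀U
    rwa [hz₀im] at this
  have hball : ball (f z₀) (9 * d) ⊆ f '' UHP := by
    intro w hw
    rw [him]
    rw [mem_ball, dist_eq_norm] at hw
    have h2 := (abs_le.1 (abs_im_le_norm (w - f z₀))).1
    rw [sub_im] at h2
    have h3 : d < w.im := by linarith
    refine ⟨hd0.trans h3, fun hwK => ?_⟩
    have := hull_im_le hK hwK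
    linarith
  have hfar := far_deriv hf hi hz₀U (by linarith) hball
  rw [hz₀im] at hfar
  have hfar' : 9 / 20 ≤ ‖deriv f z₀‖ := by nlinarith
  have hmono := uhp_mono hf hi z.re hz' hzd
  rw [re_add_im, ← hz₀, div_le_div_iff₀ (by linarith) hz'] at hmono
  have h1 : z.im ≤ 200 / 9 * d * ‖deriv f z‖ := by nlinarith
  have hn := norm_nonneg (deriv f z)
  refine ⟨by nlinarith [mul_nonneg hd0.le hn], ?_⟩
  have hne : (frontier (UHP \ K)).Nonempty := by
    rw [nonempty_frontier_iff]
    refine ⟨⟨f z, hfm z hz⟩, fun h => ?_⟩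
    have h0 : (0:ℂ) ∈ UHP \ K := h ▸ mem_univ _
    have : (0:ℝ) < (0:ℂ).im := h0.1
    simp at this
  have h2 : z.im * ‖deriv f z‖ / 2 ≤ infDist (f z) (frontier (UHP \ K)) := by
    rw [le_infDist hne]
    intro w hw
    have hw' : w ∉ f '' UHP := by
      rw [him]
      rw [hK.2.2.1.frontier_eq] at hw
      exact hw.2
    have := uhp_quarter hf hi hz hw'
    rw [dist_eq_norm]
    linarith
  have h3 : z.im ^ 2 ≤ 200 / 9 * d * (z.im * ‖deriv f z‖) := by nlinarith
  have h4 : d * (z.im * ‖deriv f z‖ / 2) ≤ d * infDist (f z) (frontier (UHP \ K)) := by gcongr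
  have h5 : 0 ≤ d * infDist (f z) (frontier (UHP \ K)) := mul_nonneg hd0.le infDist_nonneg
  nlinarith
end
end

section
/- Let f : ℍ → ℂ be holomorphic and injective, let 0 < β ≤ 1 and C₀ > 0, and suppose |f(z) − f(z')| ≤ C₀·max{|z−z'|^β, |z−z'|} for all z, z' ∈ ℍ. Then there is a constant C₁ > 0, depending only on β and C₀, such that |f'(z)| ≤ C₁·max{Im(z)^{β−1}, 1} for all z ∈ ℍ. -/
open Set Metric Filter Bornology Complex Function

noncomputable section

/-- **Lemma `f'equiv`, (i) ⇒ (ii).** A Hölder bound on a univalent map on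
`ℍ` yields a derivative bound `|f'(z)| ≤ C₁ max{Im(z)^(β-1), 1}`. -/
theorem holder_implies_deriv_bound (β C₀ : ℝ) (hβ0 : 0 < β) (hβ1 : β ≤ 1)
    (hC₀ : 0 < C₀) :
    ∃ C₁ > 0, ∀ f : ℂ → ℂ, DifferentiableOn ℂ f UHP → InjOn f UHP →
      (∀ z ∈ UHP, ∀ z' ∈ UHP, dist (f z) (f z') ≤ C₀ * max (dist z z' ^ β) (dist z z')) →
      ∀ z ∈ UHP, ‖deriv f z‖ ≤ C₁ * max (z.im ^ (β - 1)) 1 := by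
  refine ⟨2 * C₀, by positivity, ?_⟩
  intro f hf _ hH z hz
  have hy : 0 < z.im := hz
  have hsub : closedBall z (z.im / 2) ⊆ UHP := by
    intro w hw
    have h1 : |(w - z).im| ≤ z.im / 2 :=
      (Complex.abs_im_le_norm _).trans (by simpa [dist_eq_norm] using hw)
    have h2 := (abs_le.mp h1).1
    rw [Complex.sub_im] at h2
    change 0 < w.im
    linarith
  have hR : 0 < z.im / 2 := by linarith
  have hd : DiffContOnCl ℂ (fun w => f w - f z) (ball z (z.im / 2)) := by
    apply DifferentiableOn.diffContOnCl
    rw [closure_ball z hR.ne']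
    exact (hf.mono hsub).sub_const (f z)
  have key := Complex.norm_deriv_le_of_forall_mem_sphere_norm_le
    (C := C₀ * (z.im * max (z.im ^ (β - 1)) 1)) hR hd ?_
  · rw [deriv_sub_const] at key
    refine key.trans (le_of_eq ?_)
    field_simp
  · intro w hw
    have h := hH w (hsub (sphere_subset_closedBall hw)) z hz
    rw [mem_sphere.mp hw, dist_eq_norm] at h
    refine h.trans (mul_le_mul_of_nonneg_left ?_ hC₀.le)
    rw [mul_max_of_nonneg _ _ hy.le, mul_one]
    have e : z.im * z.im ^ (β - 1) = z.im ^ β := by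
      rw [Real.rpow_sub_one hy.ne']
      field_simp
    rw [e]
    exact max_le_max (Real.rpow_le_rpow hR.le (by linarith) hβ0.le) (by linarith)
end
end

section
/- Let f : ℍ → ℂ be holomorphic and injective, let 0 < β ≤ 1 and C₁ > 0, and suppose |f'(z)| ≤ C₁·max{Im(z)^{β−1}, 1} for all z ∈ ℍ. Then there is a constant C₀ > 0, depending only on β and C₁, such that |f(z) − f(z')| ≤ C₀·max{|z−z'|^β, |z−z'|} for all z, z' ∈ ℍ. -/
open Set Metric Filter Bornology Complex Function

noncomputable section

/-- Vertical estimate. -/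
lemma vertical_est (β C₁ : ℝ) (hβ0 : 0 < β) (hβ1 : β ≤ 1) (hC₁ : 0 < C₁) (f : ℂ → ℂ)
    (hf : DifferentiableOn ℂ f UHP)
    (hd : ∀ z ∈ UHP, ‖deriv f z‖ ≤ C₁ * max (z.im ^ (β - 1)) 1)
    (z : ℂ) (hz : z ∈ UHP) (d : ℝ) (hd0 : 0 < d) :
    ‖f (z + d * I) - f z‖ ≤ C₁ * (d ^ β / β + d) := by
  have hz' : 0 < z.im := hz
  have hopen : IsOpen UHP := isOpen_lt continuous_const Complex.continuous_im
  have hmem : ∀ t : ℝ, 0 ≤ t → z + t * I ∈ UHP := by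
    intro t ht
    show 0 < (z + t * I).im
    simp
    linarith
  have hder : ∀ t : ℝ, 0 ≤ t →
      HasDerivAt (fun t : ℝ => f (z + t * I) - f z) (deriv f (z + t * I) * I) t := by
    intro t ht
    have h1 : HasDerivAt f (deriv f (z + t * I)) (z + t * I) :=
      (hf.differentiableAt (hopen.mem_nhds (hmem t ht))).hasDerivAt
    have h2 : HasDerivAt (fun t : ℝ => z + (t : ℂ) * I) I t := by
      have h3 : HasDerivAt (fun t : ℝ => (t : ℂ)) 1 t := Complex.ofRealCLM.hasDerivAt
      simpa using (h3.mul_const I).const_add z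
    exact (h1.comp t h2).sub_const _
  have hB : ∀ t : ℝ, 0 ≤ t →
      HasDerivAt (fun t : ℝ => C₁ * (((z.im + t) ^ β - z.im ^ β) / β + t))
        (C₁ * ((z.im + t) ^ (β - 1) + 1)) t := by
    intro t ht
    have h1 : HasDerivAt (fun t : ℝ => z.im + t) 1 t := (hasDerivAt_id t).const_add _
    have h2 := h1.rpow_const (p := β) (Or.inl (by positivity))
    have h3 := (((h2.sub_const (z.im ^ β)).div_const β).add (hasDerivAt_id t)).const_mul C₁
    refine h3.congr_deriv ?_
    rw [one_mul, mul_div_right_comm, div_self hβ0.ne', one_mul]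
  have key := image_norm_le_of_norm_deriv_right_le_deriv_boundary'
    (f := fun t : ℝ => f (z + t * I) - f z) (f' := fun t : ℝ => deriv f (z + t * I) * I)
    (a := 0) (b := d)
    (fun t ht => (hder t ht.1).continuousAt.continuousWithinAt)
    (fun t ht => (hder t ht.1).hasDerivWithinAt)
    (B := fun t : ℝ => C₁ * (((z.im + t) ^ β - z.im ^ β) / β + t))
    (B' := fun t : ℝ => C₁ * ((z.im + t) ^ (β - 1) + 1))
    (by simp)
    (fun t ht => (hB t ht.1).continuousAt.continuousWithinAt)
    (fun t ht => (hB t ht.1).hasDerivWithinAt)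
    (by
      intro t ht
      have h := hd _ (hmem t ht.1)
      have him : (z + t * I).im = z.im + t := by simp
      rw [him] at h
      rw [norm_mul, Complex.norm_I, mul_one]
      refine h.trans ?_
      have : 0 ≤ (z.im + t) ^ (β - 1) := Real.rpow_nonneg (by linarith [ht.1]) _
      gcongr
      exact max_le (by linarith) (by linarith))
    (x := d) ⟨hd0.le, le_rfl⟩
  refine key.trans ?_
  have hs := Real.rpow_add_le_add_rpow hz'.le hd0.le hβ0.le hβ1
  gcongr
  linarith

theorem deriv_bound_implies_holder (β C₁ : ℝ) (hβ0 : 0 < β) (hβ1 : β ≤ 1)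
    (hC₁ : 0 < C₁) :
    ∃ C₀ > 0, ∀ f : ℂ → ℂ, DifferentiableOn ℂ f UHP → InjOn f UHP →
      (∀ z ∈ UHP, ‖deriv f z‖ ≤ C₁ * max (z.im ^ (β - 1)) 1) →
      ∀ z ∈ UHP, ∀ z' ∈ UHP,
        dist (f z) (f z') ≤ C₀ * max (dist z z' ^ β) (dist z z') := by
  refine ⟨C₁ * (2 / β + 4), by positivity, ?_⟩
  intro f hf _ hd z hz z' hz'
  rcases eq_or_ne z z' with rfl | hne
  · rw [dist_self]
    have : (0:ℝ) ≤ max (0 ^ β) 0 := le_max_right _ _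
    positivity
  have hd0 : 0 < dist z z' := dist_pos.2 hne
  set d := dist z z' with hdd
  have hopen : IsOpen UHP := isOpen_lt continuous_const Complex.continuous_im
  have v1 := vertical_est β C₁ hβ0 hβ1 hC₁ f hf hd z hz d hd0
  have v2 := vertical_est β C₁ hβ0 hβ1 hC₁ f hf hd z' hz' d hd0
  have hsub : ∀ w ∈ {w : ℂ | d ≤ w.im}, w ∈ UHP := fun w hw => lt_of_lt_of_le hd0 hw
  have hm : ∀ w ∈ UHP, w + d * I ∈ {w : ℂ | d ≤ w.im} := by
    intro w hw
    have : 0 < w.im := hw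
    show d ≤ (w + d * I).im
    simp
    linarith
  have h := (convex_halfSpace_im_ge d).norm_image_sub_le_of_norm_deriv_le (f := f)
    (C := C₁ * (d ^ (β - 1) + 1))
    (fun w hw => hf.differentiableAt (hopen.mem_nhds (hsub w hw)))
    (by
      intro w hw
      refine (hd w (hsub w hw)).trans ?_
      have h0 : 0 ≤ d ^ (β - 1) := Real.rpow_nonneg hd0.le _
      have h1 : w.im ^ (β - 1) ≤ d ^ (β - 1) :=
        Real.rpow_le_rpow_of_nonpos hd0 hw (by linarith)
      gcongr
      exact max_le (by linarith) (by linarith))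
    (hm z' hz') (hm z hz)
  have hn : ‖z + d * I - (z' + d * I)‖ = d := by
    rw [add_sub_add_right_eq_sub, hdd, dist_eq_norm]
  rw [hn] at h
  have hp : d ^ (β - 1) * d = d ^ β := by
    rw [Real.rpow_sub_one hd0.ne']
    field_simp
  have h' : C₁ * (d ^ (β - 1) + 1) * d = C₁ * (d ^ β + d) := by rw [← hp]; ring
  rw [h'] at h
  have tri : dist (f z) (f z') ≤ ‖f (z + d * I) - f z‖ +
      ‖f (z + d * I) - f (z' + d * I)‖ + ‖f (z' + d * I) - f z'‖ := by
    rw [← dist_eq_norm, ← dist_eq_norm, ← dist_eq_norm, dist_comm (f (z + d * I)) (f z)]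
    exact dist_triangle4 _ _ _ _
  have m1 : d ^ β ≤ max (d ^ β) d := le_max_left _ _
  have m2 : d ≤ max (d ^ β) d := le_max_right _ _
  set M := max (d ^ β) d
  calc dist (f z) (f z') ≤ C₁ * (d ^ β / β + d) + C₁ * (d ^ β + d) + C₁ * (d ^ β / β + d) := by
        linarith
    _ ≤ C₁ * (M / β + M) + C₁ * (M + M) + C₁ * (M / β + M) := by gcongr
    _ = C₁ * (2 / β + 4) * M := by ring
end
end
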